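/- For every w in the closed l∞-ball B̄_β, the smoothed function f_α is differentiable at w, and its i-th partial derivative equals α^{-1} E[df_i(w, u_{∖i})]; moreover ∇f_α(w) = E[g(w+u)] for any Borel measurable function g on B̄_{β+α/2} that agrees with the gradient ∇f almost everywhere on B̄_{β+α/2}, and ∇f_α(w) = α^{-1} E[dF(w, u, ξ)]. -/

import Mathlib

open MeasureTheory Filter
open scoped Classical BigOperators

noncomputable section

/-- The closed `l∞`-ball of radius `r` centered at `0` in `ℝ^d`. -/
def Binf (d : ℕ) (r : ℝ) : Set (EuclideanSpace ℝ (Fin d)) := {z | ∀ i, |z i| ≤ r}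

/-- The uniform probability distribution on the closed `l∞`-ball of radius `r` in `ℝ^d`. -/
def unifMeas (d : ℕ) (r : ℝ) : Measure (EuclideanSpace ℝ (Fin d)) :=
  (volume (Binf d r))⁻¹ • volume.restrict (Binf d r)

/-- The point `w + u` with its `i`-th coordinate replaced by `w i + s`. -/
def shiftPt {d : ℕ} (s : ℝ) (w u : EuclideanSpace ℝ (Fin d)) (i : Fin d) :
    EuclideanSpace ℝ (Fin d) :=
  w + u + (s - u i) • EuclideanSpace.single i (1 : ℝ)

/-- The finite difference `df_i(w, u_{∖i})` of a function `f : ℝ^d → ℝ`. -/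
def dfFD {d : ℕ} (α : ℝ) (f : EuclideanSpace ℝ (Fin d) → ℝ)
    (i : Fin d) (w u : EuclideanSpace ℝ (Fin d)) : ℝ :=
  f (shiftPt (α / 2) w u i) - f (shiftPt (-(α / 2)) w u i)

/-- The finite-difference vector `dF(w,u,ξ)` whose `i`-th component is
`F(…, w_i + α/2, …, ξ) − F(…, w_i − α/2, …, ξ)`. -/
def dFvec {d p : ℕ} (α : ℝ)
    (F : EuclideanSpace ℝ (Fin d) → EuclideanSpace ℝ (Fin p) → ℝ)
    (w u : EuclideanSpace ℝ (Fin d)) (ξ : EuclideanSpace ℝ (Fin p)) :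
    EuclideanSpace ℝ (Fin d) :=
  ∑ i : Fin d,
    (F (shiftPt (α / 2) w u i) ξ - F (shiftPt (-(α / 2)) w u i) ξ) • EuclideanSpace.single i (1 : ℝ)

/-- `f(w) := E[F(w,ξ)]`. -/
def fbar {d p : ℕ} (μξ : Measure (EuclideanSpace ℝ (Fin p)))
    (F : EuclideanSpace ℝ (Fin d) → EuclideanSpace ℝ (Fin p) → ℝ)
    (w : EuclideanSpace ℝ (Fin d)) : ℝ := ∫ ξ, F w ξ ∂μξ

/-- The randomized smoothing `f_α(w) := E[f(w+u)]`, `u` uniform on `B̄_{α/2}`. -/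
def smoothed {d : ℕ} (α : ℝ) (f : EuclideanSpace ℝ (Fin d) → ℝ)
    (w : EuclideanSpace ℝ (Fin d)) : ℝ := ∫ u, f (w + u) ∂(unifMeas d (α / 2))

/-- Resampling one coordinate of a product of probability measures leaves it invariant. -/
lemma measurePreserving_update_pi {ι : Type*} [Fintype ι] [DecidableEq ι] {X : ι → Type*}
    [∀ j, MeasurableSpace (X j)] (ν : ∀ j, Measure (X j)) [∀ j, IsProbabilityMeasure (ν j)]
    (i : ι) :
    MeasurePreserving (fun q : (∀ j, X j) × X i => Function.update q.1 i q.2)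
      ((Measure.pi ν).prod (ν i)) (Measure.pi ν) := by
  have hmeas : Measurable (fun q : (∀ j, X j) × X i => Function.update q.1 i q.2) :=
    measurable_update'
  refine ⟨hmeas, (Measure.pi_eq fun S hS => ?_).symm⟩
  have hpre : (fun q : (∀ j, X j) × X i => Function.update q.1 i q.2) ⁻¹' Set.univ.pi S =
      (Set.univ.pi (Function.update S i Set.univ)) ×ˢ S i := by
    ext q
    simp only [Set.mem_preimage, Set.mem_pi, Set.mem_univ, true_implies, Set.mem_prod]
    constructor
    · intro h
      refine ⟨fun j => ?_, by simpa using h i⟩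
      rcases eq_or_ne j i with rfl | hj
      · simp
      · simpa [hj] using h j
    · rintro ⟨h, hi⟩ j
      rcases eq_or_ne j i with rfl | hj
      · simpa using hi
      · simpa [hj] using h j
  rw [Measure.map_apply hmeas (MeasurableSet.univ_pi hS), hpre, Measure.prod_prod,
    Measure.pi_pi, ← Finset.mul_prod_erase _ _ (Finset.mem_univ i),
    ← Finset.mul_prod_erase _ (fun j => ν j (S j)) (Finset.mem_univ i)]
  have herase : ∏ j ∈ Finset.univ.erase i, ν j (Function.update S i Set.univ j) =
      ∏ j ∈ Finset.univ.erase i, ν j (S j) :=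
    Finset.prod_congr rfl fun j hj => by rw [Function.update_of_ne (Finset.ne_of_mem_erase hj)]
  rw [herase, Function.update_self, measure_univ, one_mul, mul_comm]

/-- The uniform probability distribution on `[-r, r]`. -/
def unifInterval (r : ℝ) : Measure ℝ :=
  (volume (Set.Icc (-r) r))⁻¹ • volume.restrict (Set.Icc (-r) r)

lemma isProbabilityMeasure_unifInterval {r : ℝ} (hr : 0 < r) :
    IsProbabilityMeasure (unifInterval r) := by
  refine ⟨?_⟩
  rw [unifInterval, Measure.smul_apply, Measure.restrict_apply_univ, smul_eq_mul]
  refine ENNReal.inv_mul_cancel ?_ ?_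
  · simp [Real.volume_Icc, hr]
  · simp [Real.volume_Icc]

lemma integral_unifInterval {r : ℝ} (hr : 0 < r) (k : ℝ → ℝ) :
    ∫ s, k s ∂(unifInterval r) = (2 * r)⁻¹ * ∫ s in (-r)..r, k s := by
  rw [unifInterval, integral_smul_measure, intervalIntegral.integral_of_le (by linarith),
    integral_Icc_eq_integral_Ioc, Real.volume_Icc, ENNReal.toReal_inv,
    ENNReal.toReal_ofReal (by linarith), smul_eq_mul]
  ring_nf

lemma Binf_eq_preimage_pi (d : ℕ) (r : ℝ) :
    Binf d r = WithLp.ofLp ⁻¹' (Set.univ.pi fun _ : Fin d => Set.Icc (-r) r) := by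
  ext z
  simp only [Binf, Set.mem_ofPred_eq, Set.mem_preimage, Set.mem_univ_pi, Set.mem_Icc, abs_le]

lemma measurableSet_Binf (d : ℕ) (r : ℝ) : MeasurableSet (Binf d r) := by
  rw [Binf_eq_preimage_pi]
  exact (MeasurableSet.univ_pi fun _ => measurableSet_Icc).preimage
    (PiLp.volume_preserving_ofLp (Fin d)).measurable

lemma add_mem_Binf {d : ℕ} {r s : ℝ} {x y : EuclideanSpace ℝ (Fin d)} (hx : x ∈ Binf d r)
    (hy : y ∈ Binf d s) : x + y ∈ Binf d (r + s) := fun i =>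
  (abs_add_le (x i) (y i)).trans (add_le_add (hx i) (hy i))

lemma shiftPt_apply {d : ℕ} (s : ℝ) (w u : EuclideanSpace ℝ (Fin d)) (i j : Fin d) :
    shiftPt s w u i j = w j + Function.update u.ofLp i s j := by
  rcases eq_or_ne j i with rfl | hj
  · simp [shiftPt]
  · simp [shiftPt, hj]

lemma shiftPt_mem_Binf {d : ℕ} {r s t : ℝ} (ht : |t| ≤ s) {w u : EuclideanSpace ℝ (Fin d)}
    (hw : w ∈ Binf d r) (hu : u ∈ Binf d s) (i : Fin d) : shiftPt t w u i ∈ Binf d (r + s) := by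
  intro j
  rw [shiftPt_apply]
  refine (abs_add_le _ _).trans (add_le_add (hw j) ?_)
  rcases eq_or_ne j i with rfl | hj
  · simpa using ht
  · simpa [hj] using hu j

lemma continuous_shiftPt {d : ℕ} (s : ℝ) (w : EuclideanSpace ℝ (Fin d)) (i : Fin d) :
    Continuous fun u => shiftPt s w u i := by
  unfold shiftPt
  fun_prop

lemma Binf_mem_nhds {d : ℕ} {r s : ℝ} (hrs : r < s) {x : EuclideanSpace ℝ (Fin d)}
    (hx : x ∈ Binf d r) : Binf d s ∈ nhds x := by
  have hopen : IsOpen {z : EuclideanSpace ℝ (Fin d) | ∀ i, |z i| < s} := by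
    simp only [Set.ofPred_forall]
    exact isOpen_iInter_of_finite fun i => isOpen_lt (by fun_prop) continuous_const
  exact mem_of_superset (hopen.mem_nhds fun i => (hx i).trans_lt hrs) fun z hz i => (hz i).le

lemma measurePreserving_ofLp_unifMeas (d : ℕ) {r : ℝ} (hr : 0 < r) :
    MeasurePreserving (WithLp.ofLp : EuclideanSpace ℝ (Fin d) → (Fin d → ℝ))
      (unifMeas d r) (Measure.pi fun _ => unifInterval r) := by
  have hmp := PiLp.volume_preserving_ofLp (Fin d)
  have := isProbabilityMeasure_unifInterval hr
  refine ⟨hmp.measurable, (Measure.pi_eq fun S hS => ?_).symm⟩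
  have hbox : ∀ T : Fin d → Set ℝ, (∀ j, MeasurableSet (T j)) →
      volume ((WithLp.ofLp : EuclideanSpace ℝ (Fin d) → (Fin d → ℝ)) ⁻¹' Set.univ.pi T) =
        ∏ j, volume (T j) := fun T hT => by
    rw [hmp.measure_preimage (MeasurableSet.univ_pi hT).nullMeasurableSet, volume_pi_pi]
  rw [Measure.map_apply hmp.measurable (MeasurableSet.univ_pi hS), unifMeas,
    Measure.smul_apply, Measure.restrict_apply' (measurableSet_Binf d r), Binf_eq_preimage_pi,
    ← Set.preimage_inter, ← Set.pi_inter_distrib, hbox _ fun _ => measurableSet_Icc,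
    hbox _ fun j => (hS j).inter measurableSet_Icc]
  simp only [unifInterval, Measure.smul_apply, smul_eq_mul, Finset.prod_mul_distrib,
    Measure.restrict_apply' measurableSet_Icc, Finset.prod_const, ENNReal.inv_pow]

lemma isProbabilityMeasure_unifMeas (d : ℕ) {r : ℝ} (hr : 0 < r) :
    IsProbabilityMeasure (unifMeas d r) := by
  have := isProbabilityMeasure_unifInterval hr
  have hmp := measurePreserving_ofLp_unifMeas d hr
  refine ⟨?_⟩
  rw [← Set.preimage_univ (f := WithLp.ofLp), hmp.measure_preimage nullMeasurableSet_univ,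
    measure_univ]

lemma unifMeas_absolutelyContinuous (d : ℕ) (r : ℝ) : unifMeas d r ≪ volume :=
  Measure.smul_absolutelyContinuous.trans Measure.absolutelyContinuous_restrict

lemma ae_unifMeas_mem_Binf (d : ℕ) (r : ℝ) : ∀ᵐ u ∂(unifMeas d r), u ∈ Binf d r :=
  Measure.smul_absolutelyContinuous.ae_le (ae_restrict_mem (measurableSet_Binf d r))

lemma ae_unifMeas_add {d : ℕ} {r : ℝ} {P : EuclideanSpace ℝ (Fin d) → Prop}
    (hP : ∀ᵐ x, P x) (w : EuclideanSpace ℝ (Fin d)) : ∀ᵐ u ∂(unifMeas d r), P (w + u) :=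
  (unifMeas_absolutelyContinuous d r).ae_le
    ((measurePreserving_add_left volume w).quasiMeasurePreserving.ae hP)

/-- Averaging over the uniform distribution can be done by first averaging over one coordinate. -/
lemma integral_unifMeas_eq_integral_shiftPt {d : ℕ} {r : ℝ} (hr : 0 < r)
    (w : EuclideanSpace ℝ (Fin d)) (i : Fin d) {k : EuclideanSpace ℝ (Fin d) → ℝ}
    (hk : Measurable k) {C : ℝ} (hC : ∀ x, ‖k x‖ ≤ C) :
    ∫ u, k (w + u) ∂(unifMeas d r) =
      ∫ u, ((2 * r)⁻¹ * ∫ s in (-r)..r, k (shiftPt s w u i)) ∂(unifMeas d r) := by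
  have := isProbabilityMeasure_unifInterval hr
  have := isProbabilityMeasure_unifMeas d hr
  have hmp := measurePreserving_ofLp_unifMeas d hr
  have hup := measurePreserving_update_pi (fun _ : Fin d => unifInterval r) i
  have hkm : Measurable fun v : Fin d → ℝ => k (w + WithLp.toLp 2 v) := by fun_prop
  have hpt : ∀ (u : EuclideanSpace ℝ (Fin d)) (s : ℝ),
      w + WithLp.toLp 2 (Function.update u.ofLp i s) = shiftPt s w u i := fun u s => by
    ext j
    simp [shiftPt_apply]
  have hcomp := hup.comp (hmp.prod (MeasurePreserving.id (unifInterval r)))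
  have hint : Integrable (fun q : EuclideanSpace ℝ (Fin d) × ℝ => k (shiftPt q.2 w q.1 i))
      ((unifMeas d r).prod (unifInterval r)) := by
    refine Integrable.of_bound ?_ C (Eventually.of_forall fun q => hC _)
    have := hkm.comp hcomp.measurable
    simp only [Function.comp_def, Prod.map, id, hpt] at this
    exact this.aestronglyMeasurable
  calc ∫ u, k (w + u) ∂(unifMeas d r)
      = ∫ v, k (w + WithLp.toLp 2 v) ∂(Measure.pi fun _ : Fin d => unifInterval r) := by
        rw [← hmp.map_eq, integral_map hmp.measurable.aemeasurable hkm.aestronglyMeasurable]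
    _ = ∫ q : EuclideanSpace ℝ (Fin d) × ℝ, k (shiftPt q.2 w q.1 i)
          ∂((unifMeas d r).prod (unifInterval r)) := by
        rw [← hcomp.map_eq, integral_map hcomp.measurable.aemeasurable
          hkm.aestronglyMeasurable]
        simp only [Function.comp_def, Prod.map, id, hpt]
    _ = _ := by
        rw [integral_prod _ hint]
        simp only [integral_unifInterval hr]

/-- The fundamental theorem of calculus for a Lipschitz function along a coordinate line. -/
lemma integral_lineDeriv_shiftPt {d : ℕ} {K : NNReal} {h : EuclideanSpace ℝ (Fin d) → ℝ}
    (hh : LipschitzWith K h) (w u : EuclideanSpace ℝ (Fin d)) (i : Fin d) (a b : ℝ) :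
    ∫ s in a..b, lineDeriv ℝ h (shiftPt s w u i) (EuclideanSpace.single i 1) =
      h (shiftPt b w u i) - h (shiftPt a w u i) := by
  have hline : LipschitzWith 1 fun s => shiftPt s w u i := LipschitzWith.of_dist_le_mul fun s t => by
    have hst : shiftPt s w u i - shiftPt t w u i = (s - t) • EuclideanSpace.single i (1 : ℝ) := by
      simp only [shiftPt]
      module
    rw [dist_eq_norm, hst, norm_smul, PiLp.norm_single, Real.dist_eq]
    simp
  rw [← ((hh.comp hline).lipschitzOnWith.absolutelyContinuousOnInterval
    (a := a) (b := b)).integral_deriv_eq_sub (f := fun s => h (shiftPt s w u i))]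
  refine intervalIntegral.integral_congr fun s _ => ?_
  have hshift : ∀ t : ℝ, shiftPt s w u i + t • EuclideanSpace.single i (1 : ℝ) =
      shiftPt (s + t) w u i := fun t => by
    simp only [shiftPt]
    module
  simp only [lineDeriv, hshift]
  rw [deriv_comp_const_add (f := fun t => h (shiftPt t w u i))]
  simp

/-- Averaged partial derivatives of a Lipschitz function are averaged finite differences. -/
lemma integral_lineDeriv_unifMeas {d : ℕ} {α : ℝ} (hα : 0 < α) {K : NNReal}
    {h : EuclideanSpace ℝ (Fin d) → ℝ} (hh : LipschitzWith K h) (w : EuclideanSpace ℝ (Fin d))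
    (i : Fin d) :
    ∫ u, lineDeriv ℝ h (w + u) (EuclideanSpace.single i 1) ∂(unifMeas d (α / 2)) =
      α⁻¹ * ∫ u, dfFD α h i w u ∂(unifMeas d (α / 2)) := by
  rw [integral_unifMeas_eq_integral_shiftPt (half_pos hα) w i (measurable_lineDeriv hh.continuous)
    fun x => norm_lineDeriv_le_of_lipschitz ℝ hh, ← integral_const_mul]
  simp only [integral_lineDeriv_shiftPt hh, dfFD, mul_div_cancel₀ α (two_ne_zero)]

lemma integrable_unifMeas_of_continuous {d : ℕ} {r : ℝ} {k : EuclideanSpace ℝ (Fin d) → ℝ}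
    (hr : 0 < r) (hk : Continuous k) : Integrable k (unifMeas d r) := by
  have hcompact : IsCompact (Binf d r) := by
    rw [Binf_eq_preimage_pi]
    exact (PiLp.homeomorph 2 fun _ : Fin d => ℝ).isCompact_preimage.mpr
      (isCompact_univ_pi fun _ => isCompact_Icc)
  refine (hk.continuousOn.integrableOn_compact hcompact).smul_measure (ENNReal.inv_ne_top.mpr ?_)
  exact ne_of_gt (Measure.measure_pos_of_mem_nhds volume
    (Binf_mem_nhds (x := 0) (r := 0) hr fun i => by simp))

/-- The gradient of the smoothing of a Lipschitz function is the averaged gradient. -/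
lemma hasGradientAt_smoothed {d : ℕ} {α : ℝ} (hα : 0 < α) {K : NNReal}
    {h : EuclideanSpace ℝ (Fin d) → ℝ} (hh : LipschitzWith K h)
    (w : EuclideanSpace ℝ (Fin d)) :
    Integrable (fun u => gradient h (w + u)) (unifMeas d (α / 2)) ∧
    HasGradientAt (smoothed α h) (∫ u, gradient h (w + u) ∂(unifMeas d (α / 2))) w := by
  have := isProbabilityMeasure_unifMeas d (half_pos hα)
  obtain ⟨hint, hder⟩ := hasFDerivAt_integral_of_dominated_loc_of_lip
    (μ := unifMeas d (α / 2)) (F := fun x u => h (x + u)) (x₀ := w)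
    (F' := fun u => fderiv ℝ h (w + u)) (bound := fun _ => (K : ℝ)) univ_mem
    (Eventually.of_forall fun x =>
      (hh.continuous.comp (continuous_const.add continuous_id)).aestronglyMeasurable)
    (integrable_unifMeas_of_continuous (half_pos hα)
      (hh.continuous.comp (continuous_const.add continuous_id)))
    ((measurable_fderiv ℝ h).comp (measurable_const_add w)).aestronglyMeasurable
    (Eventually.of_forall fun u => by
      simpa [Function.comp_def] using hh.comp (isometry_add_right u).lipschitz)
    (integrable_const _)
    ((ae_unifMeas_add hh.ae_differentiableAt w).mono fun u hu =>
      (hasFDerivAt_comp_add_right u).mpr hu.hasFDerivAt)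
  let e := (InnerProductSpace.toDual ℝ (EuclideanSpace ℝ (Fin d))).symm
  refine ⟨e.toContinuousLinearEquiv.toContinuousLinearMap.integrable_comp hint, ?_⟩
  have hG : ∫ u, gradient h (w + u) ∂(unifMeas d (α / 2)) =
      e (∫ u, fderiv ℝ h (w + u) ∂(unifMeas d (α / 2))) :=
    e.toContinuousLinearEquiv.toContinuousLinearMap.integral_comp_comm hint
  rw [hG, hasGradientAt_iff_hasFDerivAt, LinearIsometryEquiv.apply_symm_apply]
  exact hder


/-- The mean of a random Lipschitz function is Lipschitz with the mean constant. -/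
lemma lipschitzOnWith_fbar {d p : ℕ} {μξ : Measure (EuclideanSpace ℝ (Fin p))}
    {F : EuclideanSpace ℝ (Fin d) → EuclideanSpace ℝ (Fin p) → ℝ}
    {L0 : EuclideanSpace ℝ (Fin p) → ℝ} (hL0 : Integrable L0 μξ)
    {s : Set (EuclideanSpace ℝ (Fin d))}
    (hlip : ∀ᵐ ξ ∂μξ, ∀ w ∈ s, ∀ w' ∈ s, |F w ξ - F w' ξ| ≤ L0 ξ * ‖w - w'‖)
    (hFint : ∀ w ∈ s, Integrable (fun ξ => F w ξ) μξ) :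
    LipschitzOnWith (∫ ξ, L0 ξ ∂μξ).toNNReal (fbar μξ F) s := by
  refine LipschitzOnWith.of_dist_le_mul fun x hx y hy => ?_
  rw [dist_eq_norm, dist_eq_norm, fbar, fbar, ← integral_sub (hFint x hx) (hFint y hy)]
  calc ‖∫ ξ, F x ξ - F y ξ ∂μξ‖ ≤ ∫ ξ, L0 ξ * ‖x - y‖ ∂μξ :=
        norm_integral_le_of_norm_le (hL0.mul_const _) (hlip.mono fun ξ hξ => hξ x hx y hy)
    _ = (∫ ξ, L0 ξ ∂μξ) * ‖x - y‖ := integral_mul_const _ _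
    _ ≤ _ := by gcongr; exact Real.le_coe_toNNReal _

/-- The averaged stochastic finite differences are the averaged finite differences of the mean. -/
lemma integral_dFvec_apply {d p : ℕ} {α β : ℝ} (hα : 0 < α)
    {μξ : Measure (EuclideanSpace ℝ (Fin p))} [IsProbabilityMeasure μξ]
    {F : EuclideanSpace ℝ (Fin d) → EuclideanSpace ℝ (Fin p) → ℝ}
    (hFmeas : Measurable (Function.uncurry F))
    {L0 : EuclideanSpace ℝ (Fin p) → ℝ} (hL0 : Integrable L0 μξ)
    (hlip : ∀ᵐ ξ ∂μξ, ∀ w ∈ Binf d (β + α / 2), ∀ w' ∈ Binf d (β + α / 2),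
      |F w ξ - F w' ξ| ≤ L0 ξ * ‖w - w'‖)
    (hFint : ∀ w ∈ Binf d (β + α / 2), Integrable (fun ξ => F w ξ) μξ)
    {w : EuclideanSpace ℝ (Fin d)} (hw : w ∈ Binf d β) (i : Fin d) :
    (∫ q : EuclideanSpace ℝ (Fin d) × EuclideanSpace ℝ (Fin p),
      dFvec α F w q.1 q.2 ∂((unifMeas d (α / 2)).prod μξ)) i =
      ∫ u, dfFD α (fbar μξ F) i w u ∂(unifMeas d (α / 2)) := by
  have := isProbabilityMeasure_unifMeas d (half_pos hα)
  have hhalf : |α / 2| ≤ α / 2 := (abs_of_pos (half_pos hα)).le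
  have hmem : ∀ᵐ u ∂(unifMeas d (α / 2)), ∀ j, shiftPt (α / 2) w u j ∈ Binf d (β + α / 2) ∧
      shiftPt (-(α / 2)) w u j ∈ Binf d (β + α / 2) :=
    (ae_unifMeas_mem_Binf d (α / 2)).mono fun u hu j =>
      ⟨shiftPt_mem_Binf hhalf hw hu j, shiftPt_mem_Binf (by rwa [abs_neg]) hw hu j⟩
  have hint : ∀ j, Integrable (fun q : EuclideanSpace ℝ (Fin d) × EuclideanSpace ℝ (Fin p) =>
      F (shiftPt (α / 2) w q.1 j) q.2 - F (shiftPt (-(α / 2)) w q.1 j) q.2)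
      ((unifMeas d (α / 2)).prod μξ) := fun j => by
    have hm : ∀ t, Measurable fun q : EuclideanSpace ℝ (Fin d) × EuclideanSpace ℝ (Fin p) =>
        F (shiftPt t w q.1 j) q.2 := fun t =>
      hFmeas.comp (((continuous_shiftPt t w j).measurable.comp measurable_fst).prodMk
        measurable_snd)
    refine ((hL0.comp_snd (unifMeas d (α / 2))).mul_const α).mono'
      ((hm _).sub (hm _)).aestronglyMeasurable ?_
    filter_upwards [Measure.quasiMeasurePreserving_fst.ae hmem,
      Measure.quasiMeasurePreserving_snd.ae hlip] with q hq hLq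
    have hdiff : shiftPt (α / 2) w q.1 j - shiftPt (-(α / 2)) w q.1 j =
        α • EuclideanSpace.single j (1 : ℝ) := by
      simp only [shiftPt]
      module
    have hbound := hLq _ (hq j).1 _ (hq j).2
    rwa [hdiff, norm_smul, PiLp.norm_single, norm_one, mul_one, Real.norm_of_nonneg hα.le]
      at hbound
  have hvec : Integrable (fun q : EuclideanSpace ℝ (Fin d) × EuclideanSpace ℝ (Fin p) =>
      dFvec α F w q.1 q.2) ((unifMeas d (α / 2)).prod μξ) :=
    integrable_finsetSum _ fun j _ => (hint j).smul_const _
  have hcoord := (EuclideanSpace.proj (𝕜 := ℝ) i).integral_comp_comm hvec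
  simp only [PiLp.proj_apply] at hcoord
  rw [← hcoord]
  have happly : ∀ q : EuclideanSpace ℝ (Fin d) × EuclideanSpace ℝ (Fin p),
      dFvec α F w q.1 q.2 i =
        F (shiftPt (α / 2) w q.1 i) q.2 - F (shiftPt (-(α / 2)) w q.1 i) q.2 := fun q => by
    simp [dFvec, Finset.sum_apply, Pi.single_apply]
  simp only [happly]
  rw [integral_prod _ (hint i)]
  refine integral_congr_ae (hmem.mono fun u hu => ?_)
  exact integral_sub (hFint _ (hu i).1) (hFint _ (hu i).2)

/-- For every `w ∈ B̄_β`, the smoothed function `f_α` has a gradient `G` at `w`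
whose `i`-th component equals `α⁻¹ E[df_i(w, u_{∖i})]`; moreover `G = E[g(w+u)]` for any Borel
measurable `g` agreeing with the gradient `∇f` almost everywhere on `B̄_{β+α/2}`, and
`G = α⁻¹ E[dF(w,u,ξ)]` (expectation over the product of the uniform distribution on `B̄_{α/2}`
and the distribution of `ξ`). -/
theorem smoothed_gradient_representations
    (d p : ℕ) (α β κ : ℝ) (hα : 0 < α) (hβ : 0 < β) (hκ : β + α / 2 < κ)
    (μξ : Measure (EuclideanSpace ℝ (Fin p))) [IsProbabilityMeasure μξ]
    (F : EuclideanSpace ℝ (Fin d) → EuclideanSpace ℝ (Fin p) → ℝ)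
    (hFmeas : Measurable (Function.uncurry F))
    (hFcont : ∀ ξ, ContinuousOn (fun w => F w ξ) (Binf d κ))
    (L0 : EuclideanSpace ℝ (Fin p) → ℝ) (hL0meas : Measurable L0)
    (hL0sq : Integrable (fun ξ => (L0 ξ) ^ 2) μξ)
    (hlip : ∀ᵐ ξ ∂μξ, ∀ w ∈ Binf d κ, ∀ w' ∈ Binf d κ,
      |F w ξ - F w' ξ| ≤ L0 ξ * ‖w - w'‖)
    (hFint : ∀ w ∈ Binf d κ, Integrable (fun ξ => F w ξ) μξ)
    :
    ∀ w ∈ Binf d β, ∃ G : EuclideanSpace ℝ (Fin d),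
      HasGradientAt (smoothed α (fbar μξ F)) G w ∧
      (∀ i : Fin d,
        G i = α⁻¹ * ∫ u, dfFD α (fbar μξ F) i w u ∂(unifMeas d (α / 2))) ∧
      (∀ g : EuclideanSpace ℝ (Fin d) → EuclideanSpace ℝ (Fin d),
        Measurable g →
        (∀ᵐ x ∂(volume.restrict (Binf d (β + α / 2))), HasGradientAt (fbar μξ F) (g x) x) →
        G = ∫ u, g (w + u) ∂(unifMeas d (α / 2))) ∧
      G = α⁻¹ • ∫ q : EuclideanSpace ℝ (Fin d) × EuclideanSpace ℝ (Fin p),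
            dFvec α F w q.1 q.2 ∂((unifMeas d (α / 2)).prod μξ) := by
  intro w hw
  have hL0 : Integrable L0 μξ :=
    ((memLp_two_iff_integrable_sq hL0meas.aestronglyMeasurable).mpr hL0sq).integrable (by norm_num)
  have hsub : Binf d (β + α / 2) ⊆ Binf d κ := fun x hx i => (hx i).trans hκ.le
  obtain ⟨h, hh, heq⟩ := (lipschitzOnWith_fbar hL0 hlip hFint).extend_real
  obtain ⟨hint, hgrad⟩ := hasGradientAt_smoothed hα hh w
  have hdf : ∀ i, (∫ u, gradient h (w + u) ∂(unifMeas d (α / 2))) i =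
      α⁻¹ * ∫ u, dfFD α (fbar μξ F) i w u ∂(unifMeas d (α / 2)) := by
    intro i
    have hcoord := (EuclideanSpace.proj (𝕜 := ℝ) i).integral_comp_comm hint
    simp only [PiLp.proj_apply] at hcoord
    have hline : ∫ u, gradient h (w + u) i ∂(unifMeas d (α / 2)) =
        ∫ u, lineDeriv ℝ h (w + u) (EuclideanSpace.single i 1) ∂(unifMeas d (α / 2)) := by
      refine integral_congr_ae ((ae_unifMeas_add hh.ae_differentiableAt w).mono fun u hu => ?_)
      simp only [hu.lineDeriv_eq_fderiv]
      rw [← inner_gradient_left, EuclideanSpace.inner_single_right]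
      simp
    rw [← hcoord, hline, integral_lineDeriv_unifMeas hα hh]
    congr 1
    refine integral_congr_ae ((ae_unifMeas_mem_Binf d (α / 2)).mono fun u hu => ?_)
    have hhalf : |α / 2| ≤ α / 2 := (abs_of_pos (half_pos hα)).le
    simp only [dfFD]
    rw [heq (hsub (shiftPt_mem_Binf hhalf hw hu i)),
      heq (hsub (shiftPt_mem_Binf (by rwa [abs_neg]) hw hu i))]
  refine ⟨_, ?_, hdf, ?_, ?_⟩
  · have hnhds : Binf d (κ - α / 2) ∈ nhds w := Binf_mem_nhds (by linarith) hw
    refine hgrad.congr_of_eventuallyEq (mem_of_superset hnhds fun x hx => ?_)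
    refine integral_congr_ae ((ae_unifMeas_mem_Binf d (α / 2)).mono fun u hu => ?_)
    have hxu := add_mem_Binf hx hu
    rw [sub_add_cancel] at hxu
    exact heq hxu
  · intro g _ hg
    rw [ae_restrict_iff' (measurableSet_Binf d _)] at hg
    refine integral_congr_ae ?_
    filter_upwards [ae_unifMeas_add hg w, ae_unifMeas_mem_Binf d (α / 2)] with u hgu hu
    have hwu := add_mem_Binf hw hu
    exact ((hgu hwu).congr_of_eventuallyEq
      (mem_of_superset (Binf_mem_nhds hκ hwu) fun x hx => (heq hx).symm)).gradient
  · ext i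
    rw [hdf, PiLp.smul_apply, smul_eq_mul, integral_dFvec_apply hα hFmeas hL0
      (hlip.mono fun ξ hξ x hx y hy => hξ x (hsub hx) y (hsub hy))
      (fun x hx => hFint x (hsub hx)) hw]
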